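/- Let A be a non-deterministic Büchi automaton and let τ, ρ ∈ M(A) be elements of its transition monoid such that L(τ)·L(ρ)^ω ≠ ∅. Then L(τ)·L(ρ)^ω ⊆ L^ω(A) holds if and only if the pair (τ,ρ) is a lasso. -/

import Mathlib

/-- The concatenation `u 0 ++ u 1 ++ u 2 ++ ⋯` of an infinite sequence `u` of finite blocks
is a proper infinite word and equals the infinite word `w`. -/
def OmegaConcat {T : Type*} (u : ℕ → List T) (w : ℕ → T) : Prop :=
  (∀ n : ℕ, ∃ j : ℕ, n < (((List.range j).map u).flatten).length) ∧
  (∀ j n : ℕ, n < (((List.range j).map u).flatten).length →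
    (((List.range j).map u).flatten)[n]? = some (w n))

/-- `V·U^ω`: the set of infinite words `v u₁ u₂ u₃ ⋯` with `v ∈ V` and each `u_j ∈ U`. -/
def ProdOmega {T : Type*} (V U : Set (List T)) : Set (ℕ → T) :=
  { w | ∃ u : ℕ → List T, u 0 ∈ V ∧ (∀ j, 1 ≤ j → u j ∈ U) ∧ OmegaConcat u w }

/-- A non-deterministic Büchi automaton with state type `Q` over alphabet `T`. -/
structure NBA (T : Type*) (Q : Type*) where
  /-- initial state -/
  start : Q
  /-- set of final (accepting) states -/
  final : Set Q
  /-- transition relation -/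
  step : Q → T → Q → Prop

namespace NBA

variable {T Q : Type*}

/-- `A.Reach q u q'`: there is a `u`-labelled run from `q` to `q'` (written `q →^u q'`). -/
inductive Reach (A : NBA T Q) : Q → List T → Q → Prop
  | refl (q : Q) : Reach A q [] q
  | step {q q' q'' : Q} {a : T} {u : List T} :
      A.step q a q' → Reach A q' u q'' → Reach A q (a :: u) q''

/-- `A.ReachF q u q'`: there is a `u`-labelled run from `q` to `q'` visiting a final state
(including the endpoints), written `q →^u_f q'`. -/
def ReachF (A : NBA T Q) (q : Q) (u : List T) (q' : Q) : Prop :=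
  ∃ u₁ u₂ qf, u = u₁ ++ u₂ ∧ qf ∈ A.final ∧ A.Reach q u₁ qf ∧ A.Reach qf u₂ q'

/-- The box `ρ_u` of a finite word `u`: it contains `(q, q', 1)` iff `q →^u_f q'` and
`(q, q', 0)` iff `q →^u q'` but not `q →^u_f q'`. -/
def boxOf (A : NBA T Q) (u : List T) : Set (Q × Q × Bool) :=
  { x | (x.2.2 = true ∧ A.ReachF x.1 u x.2.1) ∨
        (x.2.2 = false ∧ A.Reach x.1 u x.2.1 ∧ ¬ A.ReachF x.1 u x.2.1) }

/-- The language `L(ρ)` of a box: all nonempty finite words whose box is `ρ`. -/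
def boxLang (A : NBA T Q) (ρ : Set (Q × Q × Bool)) : Set (List T) :=
  { u | u ≠ [] ∧ A.boxOf u = ρ }

/-- `L^ω(A)`: infinite words admitting a run from the initial state that visits final states
infinitely often. -/
def omegaLang (A : NBA T Q) : Set (ℕ → T) :=
  { w | ∃ r : ℕ → Q, r 0 = A.start ∧ (∀ n, A.step (r n) (w n) (r (n + 1))) ∧
        ∀ n, ∃ m, n ≤ m ∧ r m ∈ A.final }

end NBA

/-- A box over state set `Q`: no pair `(q, q')` carries both flags. -/
def IsBox {Q : Type*} (ρ : Set (Q × Q × Bool)) : Prop :=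
  ∀ q q' : Q, ¬ ((q, q', true) ∈ ρ ∧ (q, q', false) ∈ ρ)

/-- Composition of boxes. -/
def boxComp {Q : Type*} (ρ σ : Set (Q × Q × Bool)) : Set (Q × Q × Bool) :=
  { x | (x.2.2 = true ∧
          ∃ q'' b c, (x.1, q'', b) ∈ ρ ∧ (q'', x.2.1, c) ∈ σ ∧ (b || c) = true) ∨
        (x.2.2 = false ∧
          (∃ q'', (x.1, q'', false) ∈ ρ ∧ (q'', x.2.1, false) ∈ σ) ∧
          ¬ ∃ q'' b c, (x.1, q'', b) ∈ ρ ∧ (q'', x.2.1, c) ∈ σ ∧ (b || c) = true) }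

/-- The language of an element of the transition monoid `M(A)`: `L(id) = {ε}` and
`L(ρ)` is the box language otherwise. -/
def mLang {T Q : Type*} (A : NBA T Q) : Option (Set (Q × Q × Bool)) → Set (List T)
  | none => {[]}
  | some ρ => A.boxLang ρ

/-- The relation represented by an element of `M(A)`: `id` represents the state changes of
the empty word (`(q, q, 1)` for final `q` and `(q, q, 0)` otherwise). -/
def mRel {T Q : Type*} (A : NBA T Q) : Option (Set (Q × Q × Bool)) → Set (Q × Q × Bool)
  | none => A.boxOf []
  | some ρ => ρ

/-- The edges of the directed graph on `Q` induced by a box `ρ`. -/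
def BoxEdge {Q : Type*} (ρ : Set (Q × Q × Bool)) (p p' : Q) : Prop :=
  ∃ y, (p, p', y) ∈ ρ

/-- `(τ, ρ)` is a lasso: either `ρ = id`, or there is a transition `(q_init, q, x) ∈ τ`,
a path from `q` to `q'` in the graph of `ρ`, and a cycle from `q'` to `q'` in that graph
one of whose edges carries flag `1`. -/
def IsLasso {T Q : Type*} (A : NBA T Q)
    (τ ρ : Option (Set (Q × Q × Bool))) : Prop :=
  ρ = none ∨
    ∃ ρ' : Set (Q × Q × Bool), ρ = some ρ' ∧
      ∃ q q' : Q, (∃ x, (A.start, q, x) ∈ mRel A τ) ∧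
        Relation.ReflTransGen (BoxEdge ρ') q q' ∧
        ∃ p p' : Q, Relation.ReflTransGen (BoxEdge ρ') q' p ∧ (p, p', true) ∈ ρ' ∧
          Relation.ReflTransGen (BoxEdge ρ') p' q'

namespace NBA

variable {T Q : Type*} {A : NBA T Q}

theorem Reach.append {q q' q'' : Q} {u v : List T} (h : A.Reach q u q') (h' : A.Reach q' v q'') :
    A.Reach q (u ++ v) q'' := by
  induction h with
  | refl q => exact h'
  | step hs _ ih => exact .step hs (ih h')

theorem ReachF.reach {q q' : Q} {u : List T} (h : A.ReachF q u q') : A.Reach q u q' := by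
  obtain ⟨u₁, u₂, qf, rfl, -, h₁, h₂⟩ := h
  exact h₁.append h₂

theorem reach_of_mem_boxOf {q q' : Q} {u : List T} {y : Bool} (h : (q, q', y) ∈ A.boxOf u) :
    A.Reach q u q' := by
  rcases h with ⟨-, h⟩ | ⟨-, h, -⟩
  · exact h.reach
  · exact h

theorem mem_boxOf_true {q q' : Q} {u : List T} : (q, q', true) ∈ A.boxOf u ↔ A.ReachF q u q' := by
  simp [boxOf]

theorem Reach.exists_mem_boxOf {q q' : Q} {u : List T} (h : A.Reach q u q') :
    ∃ y, (q, q', y) ∈ A.boxOf u := by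
  by_cases hf : A.ReachF q u q'
  · exact ⟨true, .inl ⟨rfl, hf⟩⟩
  · exact ⟨false, .inr ⟨rfl, h, hf⟩⟩

/-- A finite run on the part of the infinite word `w` starting at position `a`, as a function
on positions. -/
theorem Reach.exists_run {q q' : Q} {u : List T} (h : A.Reach q u q') (w : ℕ → T) (a : ℕ)
    (hw : ∀ i (hi : i < u.length), u[i] = w (a + i)) :
    ∃ r : ℕ → Q, r a = q ∧ r (a + u.length) = q' ∧
      ∀ n, a ≤ n → n < a + u.length → A.step (r n) (w n) (r (n + 1)) := by
  induction h generalizing a with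
  | refl q => exact ⟨fun _ => q, rfl, rfl, fun n h₁ h₂ => by simp at h₂; omega⟩
  | @step q q' q'' b u hs _ ih =>
    obtain ⟨r, h₁, h₂, h₃⟩ := ih (a + 1) fun i hi => by
      have := hw (i + 1) (by simpa using hi)
      simpa [add_assoc, add_comm 1 i] using this
    refine ⟨fun n => if n ≤ a then q else r n, by simp, ?_, fun n hn hn' => ?_⟩
    · have : ¬ a + (u.length + 1) ≤ a := by omega
      simp only [List.length_cons, this, if_false]
      rwa [show a + (u.length + 1) = a + 1 + u.length by omega]
    · simp only [List.length_cons] at hn'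
      rcases hn.eq_or_lt with rfl | hlt
      · have := hw 0 (by simp)
        simp only [List.getElem_cons_zero, add_zero] at this
        simpa [h₁, ← this] using hs
      · have h4 : ¬ n ≤ a := by omega
        have h5 : ¬ n + 1 ≤ a := by omega
        simpa only [h4, h5, if_false] using h₃ n hlt (by omega)

theorem ReachF.exists_run {q q' : Q} {u : List T} (h : A.ReachF q u q') (w : ℕ → T) (a : ℕ)
    (hw : ∀ i (hi : i < u.length), u[i] = w (a + i)) :
    ∃ r : ℕ → Q, r a = q ∧ r (a + u.length) = q' ∧
      (∀ n, a ≤ n → n < a + u.length → A.step (r n) (w n) (r (n + 1))) ∧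
      ∃ m, a ≤ m ∧ m ≤ a + u.length ∧ r m ∈ A.final := by
  obtain ⟨u₁, u₂, qf, rfl, hf, h₁, h₂⟩ := h
  obtain ⟨r₁, ha₁, hb₁, hs₁⟩ := h₁.exists_run w a fun i hi => by
    rw [← hw i (by simp; omega), List.getElem_append_left hi]
  obtain ⟨r₂, ha₂, hb₂, hs₂⟩ := h₂.exists_run w (a + u₁.length) fun i hi => by
    rw [add_assoc, ← hw (u₁.length + i) (by simp; omega)]
    simp
  have key : ∀ n, a + u₁.length ≤ n →
      (if n ≤ a + u₁.length then r₁ n else r₂ n) = r₂ n := by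
    intro n hn
    split_ifs with h
    · obtain rfl : n = a + u₁.length := by omega
      rw [hb₁, ha₂]
    · rfl
  refine ⟨fun n => if n ≤ a + u₁.length then r₁ n else r₂ n, by simp [ha₁], ?_, fun n hn hn' => ?_,
    a + u₁.length, by omega, by simp, by simpa [hb₁] using hf⟩
  · rw [List.length_append]
    beta_reduce
    rw [key _ (by omega), ← hb₂, add_assoc]
  · rw [List.length_append] at hn'
    beta_reduce
    rcases lt_or_ge n (a + u₁.length) with hlt | hge
    · rw [if_pos hlt.le, if_pos (show n + 1 ≤ _ from hlt)]
      exact hs₁ n hn hlt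
    · rw [key _ hge, key _ (by omega)]
      exact hs₂ n hge (by omega)

theorem reach_of_run {w : ℕ → T} {r : ℕ → Q} (hr : ∀ n, A.step (r n) (w n) (r (n + 1)))
    (u : List T) (a : ℕ) (hw : ∀ i (hi : i < u.length), u[i] = w (a + i)) :
    A.Reach (r a) u (r (a + u.length)) := by
  induction u generalizing a with
  | nil => exact .refl _
  | cons b u ih =>
    have hb := hw 0 (by simp)
    simp only [List.getElem_cons_zero, add_zero] at hb
    have := ih (a + 1) fun i hi => by
      have := hw (i + 1) (by simpa using hi)
      simpa [add_assoc, add_comm 1 i] using this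
    rw [List.length_cons, show a + (u.length + 1) = a + 1 + u.length by omega]
    exact .step (hb ▸ hr a) this

theorem reachF_of_run {w : ℕ → T} {r : ℕ → Q} (hr : ∀ n, A.step (r n) (w n) (r (n + 1)))
    (u : List T) (a : ℕ) (hw : ∀ i (hi : i < u.length), u[i] = w (a + i))
    {m : ℕ} (hm : a ≤ m) (hm' : m ≤ a + u.length) (hf : r m ∈ A.final) :
    A.ReachF (r a) u (r (a + u.length)) := by
  obtain ⟨d, rfl⟩ := Nat.exists_eq_add_of_le hm
  have hd : d ≤ u.length := by omega
  refine ⟨u.take d, u.drop d, r (a + d), by simp, hf, ?_, ?_⟩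
  · have := reach_of_run hr (u.take d) a fun i hi => by
      rw [List.getElem_take]; exact hw _ _
    rwa [List.length_take, min_eq_left hd] at this
  · have := reach_of_run hr (u.drop d) (a + d) fun i hi => by
      rw [List.getElem_drop, add_assoc]; exact hw _ _
    rwa [List.length_drop, show a + d + (u.length - d) = a + u.length by omega] at this

end NBA

theorem exists_le_lt_succ {t : ℕ → ℕ} (h0 : t 0 = 0) (hunb : ∀ n, ∃ j, n < t j) (n : ℕ) :
    ∃ k, t k ≤ n ∧ n < t (k + 1) := by
  classical
  have hpos : Nat.find (hunb n) ≠ 0 := fun h => by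
    have := Nat.find_spec (hunb n)
    rw [h, h0] at this
    omega
  obtain ⟨k, hk⟩ := Nat.exists_eq_succ_of_ne_zero hpos
  refine ⟨k, not_lt.1 (Nat.find_min (hunb n) (by omega)), ?_⟩
  have := Nat.find_spec (hunb n)
  rwa [hk] at this

/-- Functions on consecutive intervals `[t j, t (j + 1)]` that agree at the endpoints glue to
a single function. -/
theorem exists_glue {Q : Type*} {t : ℕ → ℕ} (h0 : t 0 = 0) (hmono : Monotone t)
    (hunb : ∀ n, ∃ j, n < t j) (s : ℕ → Q) (R : ℕ → ℕ → Q)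
    (hl : ∀ j, R j (t j) = s j) (hr : ∀ j, R j (t (j + 1)) = s (j + 1)) :
    ∃ r : ℕ → Q, ∀ j m, t j ≤ m → m ≤ t (j + 1) → r m = R j m := by
  choose k hk hk' using exists_le_lt_succ h0 hunb
  have hs : ∀ i j, i ≤ j → t i = t j → s i = s j := by
    intro i j hij
    induction j, hij using Nat.le_induction with
    | base => exact fun _ => rfl
    | succ j hij ih =>
      intro h
      have h₁ := hmono hij
      have h₂ := hmono j.le_succ
      have h₃ : t j = t (j + 1) := by simp only [Nat.succ_eq_add_one] at h₂; omega
      rw [ih (by omega), ← hl j, ← hr j, h₃]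
  refine ⟨fun m => R (k m) m, fun j m hjm hmj => ?_⟩
  have hjk : j ≤ k m := by
    by_contra! h
    have := hmono (show k m + 1 ≤ j by omega)
    have := hk' m
    omega
  rcases hjk.eq_or_lt with h | h
  · beta_reduce
    rw [← h]
  · have h₁ := hmono (show j + 1 ≤ k m by omega)
    have h₂ := hk m
    have h₃ : m = t (j + 1) := by omega
    have h₄ : t (k m) = m := by omega
    have h₅ := hs (j + 1) (k m) h (by omega)
    have h₆ := hl (k m)
    rw [h₄] at h₆
    beta_reduce
    rw [h₆, ← h₅, ← hr j, ← h₃]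

/-- The position at which block `j` starts in `u 0 ++ u 1 ++ ⋯`. -/
def blockStart {T : Type*} (u : ℕ → List T) (j : ℕ) : ℕ :=
  (((List.range j).map u).flatten).length

section BlockStart

variable {T : Type*} {u : ℕ → List T} {w : ℕ → T}

@[simp]
theorem blockStart_zero : blockStart u 0 = 0 := by simp [blockStart]

theorem blockStart_succ (j : ℕ) : blockStart u (j + 1) = blockStart u j + (u j).length := by
  simp [blockStart, List.range_succ]

theorem blockStart_mono : Monotone (blockStart u) :=
  monotone_nat_of_le_succ fun j => by simp [blockStart_succ]

theorem OmegaConcat.getElem_eq (h : OmegaConcat u w) (j i : ℕ) (hi : i < (u j).length) :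
    (u j)[i] = w (blockStart u j + i) := by
  have := h.2 (j + 1) (blockStart u j + i) (by
    change _ < blockStart u (j + 1)
    rw [blockStart_succ]
    omega)
  rw [List.range_succ, List.map_append, List.flatten_append,
    List.getElem?_append_right (by simp [blockStart])] at this
  simpa [blockStart, List.getElem?_eq_some_iff, hi] using this

end BlockStart

/-- Vertices reaching `p` can be ranked by the length of some path to `p`. -/
theorem exists_countdown {Q : Type*} {E : Q → Q → Prop} {p : Q} :
    ∃ D : ℕ → Q → Prop, (∀ x, D 0 x → x = p) ∧ (∀ n x, D (n + 1) x → ∃ y, E x y ∧ D n y) ∧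
      ∀ x, Relation.ReflTransGen E x p → ∃ n, D n x := by
  refine ⟨fun n => Nat.rec (· = p) (fun _ D x => ∃ y, E x y ∧ D y) n, fun x h => h,
    fun n x h => h, fun x hx => ?_⟩
  induction hx using Relation.ReflTransGen.head_induction_on with
  | refl => exact ⟨0, rfl⟩
  | head hxy _ ih =>
    obtain ⟨n, hn⟩ := ih
    exact ⟨n + 1, _, hxy, hn⟩

/-- From a vertex that reaches a marked edge lying on a cycle there is an infinite path using
marked edges infinitely often. -/
theorem exists_path_frequently_marked {Q : Type*} {ρ : Set (Q × Q × Bool)} {q p p' : Q}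
    (hq : Relation.ReflTransGen (BoxEdge ρ) q p) (hp : (p, p', true) ∈ ρ)
    (hp' : Relation.ReflTransGen (BoxEdge ρ) p' p) :
    ∃ s : ℕ → Q, s 0 = q ∧ (∀ j, BoxEdge ρ (s j) (s (j + 1))) ∧
      ∀ n, ∃ m, n ≤ m ∧ (s m, s (m + 1), true) ∈ ρ := by
  obtain ⟨D, hD0, hDs, hD⟩ := exists_countdown (E := BoxEdge ρ) (p := p)
  have hnext : ∀ c : {c : ℕ × Q // D c.1 c.2}, ∃ c' : {c : ℕ × Q // D c.1 c.2},
      BoxEdge ρ c.1.2 c'.1.2 ∧ (c.1.1 = 0 → (c.1.2, c'.1.2, true) ∈ ρ) ∧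
        (c.1.1 ≠ 0 → c'.1.1 < c.1.1) := by
    rintro ⟨⟨_ | n, x⟩, hx⟩
    · obtain rfl := hD0 x hx
      obtain ⟨n, hn⟩ := hD p' hp'
      exact ⟨⟨(n, p'), hn⟩, ⟨true, hp⟩, fun _ => hp, fun h => absurd rfl h⟩
    · obtain ⟨y, hxy, hy⟩ := hDs n x hx
      exact ⟨⟨(n, y), hy⟩, hxy, fun h => by simp at h, fun _ => by simp⟩
  choose next h₁ h₂ h₃ using hnext
  obtain ⟨n₀, hn₀⟩ := hD q hq
  let c : ℕ → {c : ℕ × Q // D c.1 c.2} := fun n => next^[n] ⟨(n₀, q), hn₀⟩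
  have hc : ∀ n, c (n + 1) = next (c n) := fun n => Function.iterate_succ_apply' _ _ _
  refine ⟨fun n => (c n).1.2, rfl, fun j => by beta_reduce; rw [hc]; exact h₁ _, fun n => ?_⟩
  induction hd : (c n).1.1 using Nat.strong_induction_on generalizing n with
  | _ d ih =>
    by_cases h : (c n).1.1 = 0
    · exact ⟨n, le_rfl, by beta_reduce; rw [hc]; exact h₂ _ h⟩
    · obtain ⟨m, hm, hm'⟩ := ih _ (by rw [← hd, hc]; exact h₃ _ h) (n + 1) rfl
      exact ⟨m, by omega, hm'⟩

theorem boxOf_eq_mRel {T Q : Type*} {A : NBA T Q} {τ : Option (Set (Q × Q × Bool))} {v : List T}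
    (h : v ∈ mLang A τ) : A.boxOf v = mRel A τ := by
  cases τ with
  | none => obtain rfl : v = [] := h; rfl
  | some b => exact h.2

theorem prodOmega_singleton_nil {T : Type*} (V : Set (List T)) : ProdOmega V {[]} = ∅ := by
  refine Set.eq_empty_of_forall_notMem ?_
  rintro w ⟨u, -, hu, hw, -⟩
  have key : ∀ j, blockStart u j ≤ (u 0).length := by
    intro j
    induction j with
    | zero => simp
    | succ j ih =>
      rw [blockStart_succ]
      rcases Nat.eq_zero_or_pos j with rfl | hj
      · simp
      · have : u j = [] := hu j hj
        simpa [this] using ih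
  obtain ⟨j, hj⟩ := hw (u 0).length
  exact absurd hj (not_lt.2 (key j))

/-- A word split into blocks is accepted once the blocks link up states through reachability,
infinitely often visiting a final state. -/
theorem OmegaConcat.mem_omegaLang {T Q : Type*} {A : NBA T Q} {u : ℕ → List T} {w : ℕ → T}
    (h : OmegaConcat u w) (s : ℕ → Q) (h0 : s 0 = A.start)
    (hs : ∀ j, A.Reach (s j) (u j) (s (j + 1)))
    (hf : ∀ n, ∃ m, n ≤ m ∧ A.ReachF (s m) (u m) (s (m + 1))) : w ∈ A.omegaLang := by
  have hR : ∀ j, ∃ r : ℕ → Q, r (blockStart u j) = s j ∧ r (blockStart u (j + 1)) = s (j + 1) ∧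
      (∀ n, blockStart u j ≤ n → n < blockStart u (j + 1) → A.step (r n) (w n) (r (n + 1))) ∧
      (A.ReachF (s j) (u j) (s (j + 1)) →
        ∃ m, blockStart u j ≤ m ∧ m ≤ blockStart u (j + 1) ∧ r m ∈ A.final) := by
    intro j
    rw [blockStart_succ]
    by_cases hj : A.ReachF (s j) (u j) (s (j + 1))
    · obtain ⟨r, h₁, h₂, h₃, h₄⟩ := hj.exists_run w _ (h.getElem_eq j)
      exact ⟨r, h₁, h₂, h₃, fun _ => h₄⟩
    · obtain ⟨r, h₁, h₂, h₃⟩ := (hs j).exists_run w _ (h.getElem_eq j)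
      exact ⟨r, h₁, h₂, h₃, fun h => absurd h hj⟩
  choose R h₁ h₂ h₃ h₄ using hR
  obtain ⟨r, hr⟩ := exists_glue blockStart_zero blockStart_mono h.1 s R h₁ h₂
  refine ⟨r, ?_, fun n => ?_, fun n => ?_⟩
  · have := h₁ 0
    rw [blockStart_zero] at this
    rw [hr 0 0 (by simp) (by simp), this, h0]
  · obtain ⟨k, hk, hk'⟩ := exists_le_lt_succ blockStart_zero h.1 n
    change n < blockStart u (k + 1) at hk'
    rw [hr k n hk hk'.le, hr k (n + 1) (le_trans hk n.le_succ) hk']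
    exact h₃ k n hk hk'
  · obtain ⟨j, hj⟩ := h.1 n
    obtain ⟨m, hm, hmf⟩ := hf j
    obtain ⟨i, hi, hi', hif⟩ := h₄ m hmf
    refine ⟨i, ?_, by rwa [hr m i hi hi']⟩
    exact (lt_of_lt_of_le hj (blockStart_mono hm)).le.trans hi

/-- An accepted word split into blocks links up states through reachability, infinitely often
visiting a final state. -/
theorem OmegaConcat.exists_states {T Q : Type*} {A : NBA T Q} {u : ℕ → List T} {w : ℕ → T}
    (h : OmegaConcat u w) (hw : w ∈ A.omegaLang) :
    ∃ s : ℕ → Q, s 0 = A.start ∧ (∀ j, A.Reach (s j) (u j) (s (j + 1))) ∧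
      ∀ n, ∃ m, n ≤ m ∧ A.ReachF (s m) (u m) (s (m + 1)) := by
  obtain ⟨r, h0, hr, hf⟩ := hw
  refine ⟨fun j => r (blockStart u j), by simpa using h0, fun j => ?_, fun n => ?_⟩
  · simpa only [blockStart_succ] using NBA.reach_of_run hr (u j) _ (h.getElem_eq j)
  · obtain ⟨m, hm, hmf⟩ := hf (blockStart u n)
    obtain ⟨k, hk, hk'⟩ := exists_le_lt_succ blockStart_zero h.1 m
    change m < blockStart u (k + 1) at hk'
    refine ⟨k, ?_, ?_⟩
    · by_contra! hkn
      have := blockStart_mono (u := u) (show k + 1 ≤ n from hkn)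
      omega
    · rw [blockStart_succ] at hk'
      simpa only [blockStart_succ] using
        NBA.reachF_of_run hr (u k) _ (h.getElem_eq k) hk hk'.le hmf


/-- for `τ, ρ ∈ M(A)` with `L(τ)·L(ρ)^ω ≠ ∅`, the inclusion
`L(τ)·L(ρ)^ω ⊆ L^ω(A)` holds iff `(τ, ρ)` is a lasso. -/
theorem prodOmega_subset_omegaLang_iff_isLasso {T Q : Type} [Finite T] [Finite Q]
    (A : NBA T Q) (τ ρ : Option (Set (Q × Q × Bool)))
    (hτ : ∀ b, τ = some b → IsBox b) (hρ : ∀ b, ρ = some b → IsBox b)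
    (hne : (ProdOmega (mLang A τ) (mLang A ρ)).Nonempty) :
    ProdOmega (mLang A τ) (mLang A ρ) ⊆ A.omegaLang ↔ IsLasso A τ ρ := by
  constructor
  · intro hsub
    obtain ⟨w, hw⟩ := hne
    obtain ⟨u, hu0, hu, hc⟩ := id hw
    obtain ⟨s, hs0, hs, hf⟩ := hc.exists_states (hsub hw)
    cases ρ with
    | none => exact .inl rfl
    | some ρ =>
      have hbox : ∀ j, 1 ≤ j → A.boxOf (u j) = ρ := fun j hj => (hu j hj).2
      have hedge : ∀ j, 1 ≤ j → BoxEdge ρ (s j) (s (j + 1)) := fun j hj =>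
        hbox j hj ▸ (hs j).exists_mem_boxOf
      have hpath : ∀ i j, 1 ≤ i → i ≤ j → Relation.ReflTransGen (BoxEdge ρ) (s i) (s j) := by
        intro i j hi hij
        induction j, hij using Nat.le_induction with
        | base => exact .refl
        | succ j hij ih => exact ih.tail (hedge j (hi.trans hij))
      have hinf : {j | 1 ≤ j ∧ (s j, s (j + 1), true) ∈ ρ}.Infinite := by
        refine Set.infinite_of_forall_exists_gt fun n => ?_
        obtain ⟨m, hm, hmf⟩ := hf (n + 1)
        exact ⟨m, ⟨by omega, hbox m (by omega) ▸ NBA.mem_boxOf_true.2 hmf⟩, hm⟩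
      obtain ⟨i, ⟨hi, hit⟩, j, -, hij, hsij⟩ :=
        hinf.exists_lt_map_eq_of_mapsTo (f := s) (Set.mapsTo_univ _ _) Set.finite_univ
      refine .inr ⟨ρ, rfl, s 1, s i, ?_, hpath 1 i le_rfl hi, s i, s (i + 1), .refl, hit, ?_⟩
      · rw [← boxOf_eq_mRel hu0, ← hs0]
        exact (hs 0).exists_mem_boxOf
      · rw [hsij]
        exact hpath (i + 1) j (by omega) hij
  · rintro (rfl | ⟨ρ, rfl, q, q', ⟨x, hx⟩, hqq', p, p', hp, hpp', hp'⟩)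
    · rw [show mLang A none = {[]} from rfl, prodOmega_singleton_nil]
      exact Set.empty_subset _
    · rintro w ⟨u, hu0, hu, hc⟩
      have hbox : ∀ j, A.boxOf (u (j + 1)) = ρ := fun j => (hu (j + 1) (by omega)).2
      obtain ⟨s, hs0, hs, hf⟩ := exists_path_frequently_marked (hqq'.trans hp) hpp' (hp'.trans hp)
      refine hc.mem_omegaLang (fun j => Nat.casesOn j A.start s) rfl (fun j => ?_) fun n => ?_
      · cases j with
        | zero =>
          rw [← boxOf_eq_mRel hu0, ← hs0] at hx
          exact NBA.reach_of_mem_boxOf hx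
        | succ j =>
          obtain ⟨y, hy⟩ := hs j
          rw [← hbox j] at hy
          exact NBA.reach_of_mem_boxOf hy
      · obtain ⟨m, hm, hmt⟩ := hf n
        rw [← hbox m] at hmt
        exact ⟨m + 1, by omega, NBA.mem_boxOf_true.1 hmt⟩
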